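/- Let γ ∈ [-1,1], μ ≥ 1, K ≥ 1, and let τ₁, τ₂ ⊆ [0,1]² be axis-parallel squares of side length at most μ^{1/2}K^{-1}, with centers z₁^c = (x₁^c, y₁^c) and z₂^c = (x₂^c, y₂^c) respectively. Assume |y₂^c - y₁^c| ≥ 10μ^{1/2}K^{-1} and |t^γ_{z₂^c}(z₁^c,z₂^c)| ≥ 10μ^{1/2}K^{-1}. Then |Γ^γ_z(z₁,z₂,z₁',z₂')| ≥ 4μK^{-2} for all z₁, z₁' ∈ τ₁ and all z, z₂, z₂' ∈ τ₂. -/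

import Mathlib

open Matrix

noncomputable section

/-- The gradient `∇φ_γ(x,y) = (y, x + γy²)` of `φ_γ(x,y) = xy + (γ/3)y³`. -/
def gradPhi (γ : ℝ) (z : ℝ × ℝ) : Fin 2 → ℝ :=
  ![z.2, z.1 + γ * z.2 ^ 2]

/-- The Hessian `Hφ_γ(x,y) = [[0,1],[1,2γy]]`. -/
def hessPhi (γ : ℝ) (z : ℝ × ℝ) : Matrix (Fin 2) (Fin 2) ℝ :=
  !![0, 1; 1, 2 * γ * z.2]

/-- The four-point transversality quantity
`Γ^γ_z(z₁,z₂,z₁',z₂') = ⟨(Hφ_γ(z))⁻¹(∇φ_γ(z₂) - ∇φ_γ(z₁)), ∇φ_γ(z₂') - ∇φ_γ(z₁')⟩`. -/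
def GammaFour (γ : ℝ) (z z₁ z₂ z₁' z₂' : ℝ × ℝ) : ℝ :=
  ((hessPhi γ z)⁻¹ *ᵥ (gradPhi γ z₂ - gradPhi γ z₁)) ⬝ᵥ
    (gradPhi γ z₂' - gradPhi γ z₁')

/-- The quantity `t^γ_z(z₁,z₂) = x₂ - x₁ + γ(y₁+y₂-y)(y₂-y₁)`. -/
def tQuant (γ : ℝ) (z z₁ z₂ : ℝ × ℝ) : ℝ :=
  z₂.1 - z₁.1 + γ * (z₁.2 + z₂.2 - z.2) * (z₂.2 - z₁.2)

/-- The axis-parallel square with center `c` and side length `s`. -/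
def sqCap (c : ℝ × ℝ) (s : ℝ) : Set (ℝ × ℝ) :=
  Set.Icc (c.1 - s / 2) (c.1 + s / 2) ×ˢ Set.Icc (c.2 - s / 2) (c.2 + s / 2)

/-- The four-point quantity in terms of `y`-differences and `tQuant`. -/
theorem GammaFour_eq (γ : ℝ) (z z₁ z₂ z₁' z₂' : ℝ × ℝ) :
    GammaFour γ z z₁ z₂ z₁' z₂' =
      (z₂'.2 - z₁'.2) * tQuant γ z z₁ z₂ + (z₂.2 - z₁.2) * tQuant γ z z₁' z₂' := by
  have hinv : (hessPhi γ z)⁻¹ = !![-(2 * γ * z.2), 1; 1, 0] := by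
    apply Matrix.inv_eq_right_inv
    ext i j
    fin_cases i <;> fin_cases j <;> simp [hessPhi, Matrix.mul_apply, Fin.sum_univ_two]
  rw [GammaFour, hinv]
  simp only [gradPhi, tQuant, Matrix.mulVec, dotProduct, Fin.sum_univ_two, Pi.sub_apply,
    Matrix.of_apply, Matrix.cons_val_zero, Matrix.cons_val_one]
  ring

theorem abs_mul_sub_mul_le {a a₀ b b₀ δ ε : ℝ} (ha : |a - a₀| ≤ δ) (hb : |b - b₀| ≤ ε)
    (ha₀ : |a₀| ≤ 1) (hb₁ : |b| ≤ 1) : |a * b - a₀ * b₀| ≤ δ + ε := by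
  have h₁ : |(a - a₀) * b| ≤ δ := by
    rw [abs_mul]
    exact (mul_le_of_le_one_right (abs_nonneg _) hb₁).trans ha
  have h₂ : |a₀ * (b - b₀)| ≤ ε := by
    rw [abs_mul]
    exact (mul_le_of_le_one_left (abs_nonneg _) ha₀).trans hb
  calc |a * b - a₀ * b₀| = |(a - a₀) * b + a₀ * (b - b₀)| := by ring_nf
    _ ≤ |(a - a₀) * b| + |a₀ * (b - b₀)| := abs_add_le _ _
    _ ≤ δ + ε := add_le_add h₁ h₂

/-- `z₂.2 - z₁.2` and `tQuant γ z z₁ z₂` vary little as the points range over the two squares. -/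
theorem abs_sub_le_of_mem_sqCap {γ r s₁ s₂ : ℝ} {c₁ c₂ z z₁ z₂ : ℝ × ℝ} (hγ : |γ| ≤ 1)
    (hs₁ : 0 < s₁) (hs₁r : s₁ ≤ r) (hs₂r : s₂ ≤ r)
    (hsub₁ : sqCap c₁ s₁ ⊆ Set.Icc (0:ℝ) 1 ×ˢ Set.Icc (0:ℝ) 1)
    (hsub₂ : sqCap c₂ s₂ ⊆ Set.Icc (0:ℝ) 1 ×ˢ Set.Icc (0:ℝ) 1)
    (hz : z ∈ sqCap c₂ s₂) (hz₁ : z₁ ∈ sqCap c₁ s₁) (hz₂ : z₂ ∈ sqCap c₂ s₂) :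
    |(z₂.2 - z₁.2) - (c₂.2 - c₁.2)| ≤ r ∧
      |tQuant γ z z₁ z₂ - tQuant γ c₂ c₁ c₂| ≤ 4 * r := by
  have hc₁ : c₁ ∈ sqCap c₁ s₁ := by
    simp only [sqCap, Set.mem_prod, Set.mem_Icc]
    refine ⟨⟨?_, ?_⟩, ?_, ?_⟩ <;> linarith
  obtain ⟨-, hc₁l, hc₁u⟩ := hsub₁ hc₁
  obtain ⟨-, hz₁l, hz₁u⟩ := hsub₁ hz₁
  obtain ⟨-, hz₂l, hz₂u⟩ := hsub₂ hz₂
  obtain ⟨-, hy, hy'⟩ := hz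
  obtain ⟨⟨hx₁, hx₁'⟩, hy₁, hy₁'⟩ := hz₁
  obtain ⟨⟨hx₂, hx₂'⟩, hy₂, hy₂'⟩ := hz₂
  have hY : |(z₂.2 - z₁.2) - (c₂.2 - c₁.2)| ≤ r := by
    rw [abs_le]
    constructor <;> linarith
  refine ⟨hY, ?_⟩
  have hX : |(z₂.1 - z₁.1) - (c₂.1 - c₁.1)| ≤ r := by
    rw [abs_le]
    constructor <;> linarith
  have hA : |(z₁.2 + z₂.2 - z.2) - c₁.2| ≤ 2 * r := by
    rw [abs_le]
    constructor <;> linarith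
  have hc : |c₁.2| ≤ 1 := by
    rw [abs_le]
    constructor <;> linarith
  have hB : |z₂.2 - z₁.2| ≤ 1 := by
    rw [abs_le]
    constructor <;> linarith
  have hP := abs_mul_sub_mul_le hA hY hc hB
  have hγP := (mul_le_of_le_one_left (abs_nonneg _) hγ).trans hP
  rw [← abs_mul] at hγP
  calc |tQuant γ z z₁ z₂ - tQuant γ c₂ c₁ c₂|
      = |((z₂.1 - z₁.1) - (c₂.1 - c₁.1)) +
          γ * ((z₁.2 + z₂.2 - z.2) * (z₂.2 - z₁.2) - c₁.2 * (c₂.2 - c₁.2))| := by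
        unfold tQuant
        ring_nf
    _ ≤ r + (2 * r + r) := (abs_add_le _ _).trans (add_le_add hX hγP)
    _ = 4 * r := by ring

/-- Perturbations of large numbers keep their signs, so two such products cannot cancel. -/
theorem le_abs_mul_add_mul {r A B a a' b b' : ℝ} (hr : 0 ≤ r)
    (hA : 10 * r ≤ |A|) (hB : 10 * r ≤ |B|) (ha : |a - A| ≤ r) (ha' : |a' - A| ≤ r)
    (hb : |b - B| ≤ 4 * r) (hb' : |b' - B| ≤ 4 * r) :
    4 * r ^ 2 ≤ |a' * b + a * b'| := by
  rw [abs_le] at ha ha' hb hb'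
  obtain ⟨ha, ha₁⟩ := ha
  obtain ⟨ha', ha₁'⟩ := ha'
  obtain ⟨hb, hb₁⟩ := hb
  obtain ⟨hb', hb₁'⟩ := hb'
  have key : ∀ {u v : ℝ}, 2 * r ≤ u → 2 * r ≤ v → 4 * r ^ 2 ≤ u * v := fun hu hv => by
    nlinarith [mul_le_mul hu hv (by positivity) (by linarith)]
  have hr2 := sq_nonneg r
  rw [le_abs] at hA hB ⊢
  rcases hA with hA | hA <;> rcases hB with hB | hB
  · left
    have h₁ := key (u := a') (v := b) (by linarith) (by linarith)
    have h₂ := key (u := a) (v := b') (by linarith) (by linarith)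
    linarith
  · right
    have h₁ := key (u := a') (v := -b) (by linarith) (by linarith)
    have h₂ := key (u := a) (v := -b') (by linarith) (by linarith)
    linarith
  · right
    have h₁ := key (u := -a') (v := b) (by linarith) (by linarith)
    have h₂ := key (u := -a) (v := b') (by linarith) (by linarith)
    linarith
  · left
    have h₁ := key (u := -a') (v := -b) (by linarith) (by linarith)
    have h₂ := key (u := -a) (v := -b') (by linarith) (by linarith)
    linarith

/-- Lower bound for the four-point transversality quantity between two strongly
separated caps: if `τ₁, τ₂ ⊆ [0,1]²` are axis-parallel squares of side at most
`μ^{1/2}K^{-1}` whose centers satisfy `|y₂^c - y₁^c| ≥ 10 μ^{1/2} K^{-1}` and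
`|t^γ_{z₂^c}(z₁^c, z₂^c)| ≥ 10 μ^{1/2} K^{-1}`, then
`|Γ^γ_z(z₁,z₂,z₁',z₂')| ≥ 4μK⁻²` for all `z₁, z₁' ∈ τ₁` and `z, z₂, z₂' ∈ τ₂`. -/
theorem GammaFour_lower_bound
    (γ μ K : ℝ) (hγ : γ ∈ Set.Icc (-1:ℝ) 1) (hμ : 1 ≤ μ) (hK : 1 ≤ K)
    (c₁ c₂ : ℝ × ℝ) (s₁ s₂ : ℝ)
    (hs₁ : 0 < s₁) (hs₂ : 0 < s₂)
    (hs₁' : s₁ ≤ Real.sqrt μ * K⁻¹) (hs₂' : s₂ ≤ Real.sqrt μ * K⁻¹)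
    (hsub₁ : sqCap c₁ s₁ ⊆ Set.Icc (0:ℝ) 1 ×ˢ Set.Icc (0:ℝ) 1)
    (hsub₂ : sqCap c₂ s₂ ⊆ Set.Icc (0:ℝ) 1 ×ˢ Set.Icc (0:ℝ) 1)
    (hysep : 10 * Real.sqrt μ * K⁻¹ ≤ |c₂.2 - c₁.2|)
    (htsep : 10 * Real.sqrt μ * K⁻¹ ≤ |tQuant γ c₂ c₁ c₂|) :
    ∀ z₁ ∈ sqCap c₁ s₁, ∀ z₁' ∈ sqCap c₁ s₁,
    ∀ z ∈ sqCap c₂ s₂, ∀ z₂ ∈ sqCap c₂ s₂, ∀ z₂' ∈ sqCap c₂ s₂,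
      4 * μ * (K ^ 2)⁻¹ ≤ |GammaFour γ z z₁ z₂ z₁' z₂'| := by
  intro z₁ hz₁ z₁' hz₁' z hz z₂ hz₂ z₂' hz₂'
  have hγ' : |γ| ≤ 1 := abs_le.2 hγ
  obtain ⟨hY, hT⟩ := abs_sub_le_of_mem_sqCap hγ' hs₁ hs₁' hs₂' hsub₁ hsub₂ hz hz₁ hz₂
  obtain ⟨hY', hT'⟩ := abs_sub_le_of_mem_sqCap hγ' hs₁ hs₁' hs₂' hsub₁ hsub₂ hz hz₁' hz₂'
  rw [mul_assoc] at hysep htsep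
  have h := le_abs_mul_add_mul (hs₁.le.trans hs₁') hysep htsep hY hY' hT hT'
  rwa [mul_pow, Real.sq_sqrt (by linarith), inv_pow, ← mul_assoc, ← GammaFour_eq] at h

end
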